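/- Let g : S → ℝ be continuously differentiable, let M, L > 0, and let ρᵈ : ℝ≥0 × S → ℝ be continuously differentiable with ‖ρᵈ(t,·)‖₂ ≤ M and ‖ρᵈ_x(t,·)‖₂ ≤ L for all t ≥ 0. Let e : ℝ≥0 × S → ℝ be a continuously differentiable solution (C¹ in t, C² in x) of e_t = −K_p e + [ρᵈ Ṽ]_x − [e Ṽ]_x with Ṽ(t,·) = g * e(t,·). Then for all t ≥ 0, the time derivative of ‖e(t,·)‖₂² is at most ( −2K_p + 2M‖g_x‖₂ + 2L‖g‖₂ + ‖g_x‖₂ ‖e(t,·)‖₂ ) ‖e(t,·)‖₂². -/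

import Mathlib

open MeasureTheory Real Filter

/-- The `L²`-norm on the circle `S = [-π, π]` (endpoints identified). -/
noncomputable def L2norm (h : ℝ → ℝ) : ℝ :=
  Real.sqrt (∫ x in (-Real.pi)..Real.pi, h x ^ 2)

/-- Circular convolution on `S = [-π, π]`. -/
noncomputable def circConv (f g : ℝ → ℝ) : ℝ → ℝ :=
  fun x => ∫ y in (-Real.pi)..Real.pi, f (x - y) * g y

/-- Differentiation under the integral sign for jointly continuous integrands. -/
theorem hasDerivAt_intervalIntegral_of_continuous_deriv {F F' : ℝ → ℝ → ℝ}
    (hF : Continuous F.uncurry) (hF' : Continuous F'.uncurry)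
    (hd : ∀ x y, HasDerivAt (fun z => F z y) (F' x y) x) (a b x₀ : ℝ) :
    HasDerivAt (fun x => ∫ y in a..b, F x y) (∫ y in a..b, F' x₀ y) x₀ := by
  have hFx (x : ℝ) : Continuous (F x) := hF.comp (by fun_prop : Continuous fun y : ℝ => (x, y))
  have hF'x (x : ℝ) : Continuous (F' x) := hF'.comp (by fun_prop : Continuous fun y : ℝ => (x, y))
  obtain ⟨C, hC⟩ := ((isCompact_closedBall x₀ 1).prod
    (isCompact_uIcc (a := a) (b := b))).exists_bound_of_continuousOn hF'.continuousOn
  exact (intervalIntegral.hasDerivAt_integral_of_dominated_loc_of_deriv_le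
    (s := Metric.closedBall x₀ 1) (bound := fun _ => C)
    (Metric.closedBall_mem_nhds x₀ one_pos)
    (Eventually.of_forall fun x => (hFx x).aestronglyMeasurable)
    ((hFx x₀).intervalIntegrable a b) (hF'x x₀).aestronglyMeasurable
    (Eventually.of_forall fun y hy x hx =>
      hC (x, y) ⟨hx, Set.uIoc_subset_uIcc hy⟩)
    intervalIntegrable_const
    (Eventually.of_forall fun y _ x _ => hd x y)).2

theorem Function.Periodic.deriv_real {f : ℝ → ℝ} {c : ℝ} (hf : Function.Periodic f c) :
    Function.Periodic (deriv f) c := by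
  intro x
  rw [← deriv_comp_add_const]
  exact congrArg (fun h => deriv h x) (funext hf)

theorem L2norm_nonneg (f : ℝ → ℝ) : 0 ≤ L2norm f := Real.sqrt_nonneg _

theorem L2norm_sq (f : ℝ → ℝ) : L2norm f ^ 2 = ∫ x in (-π)..π, f x ^ 2 :=
  Real.sq_sqrt (intervalIntegral.integral_nonneg (by linarith [pi_pos]) fun _ _ => sq_nonneg _)

/-- The Cauchy–Schwarz inequality on the circle. -/
theorem abs_integral_mul_le_L2norm_mul {f h : ℝ → ℝ} (hf : Continuous f) (hh : Continuous h) :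
    |∫ x in (-π)..π, f x * h x| ≤ L2norm f * L2norm h := by
  have key : ∀ s : ℝ, 0 ≤ L2norm h ^ 2 * (s * s) + (2 * ∫ x in (-π)..π, f x * h x) * s
      + L2norm f ^ 2 := by
    intro s
    have h0 : 0 ≤ ∫ x in (-π)..π, (s * h x + f x) ^ 2 :=
      intervalIntegral.integral_nonneg (by linarith [pi_pos]) fun _ _ => sq_nonneg _
    have h1 : ∫ x in (-π)..π, (s * h x + f x) ^ 2
        = ∫ x in (-π)..π, (s * s * h x ^ 2 + 2 * s * (f x * h x) + f x ^ 2) := by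
      congr 1; ext x; ring
    rw [h1, intervalIntegral.integral_add, intervalIntegral.integral_add,
      intervalIntegral.integral_const_mul, intervalIntegral.integral_const_mul,
      ← L2norm_sq, ← L2norm_sq] at h0
    · linarith
    all_goals exact Continuous.intervalIntegrable (by fun_prop) _ _
  have hd := discrim_le_zero key
  rw [discrim] at hd
  refine abs_le_of_sq_le_sq ?_ (mul_nonneg (L2norm_nonneg f) (L2norm_nonneg h))
  nlinarith

theorem abs_integral_mul_mul_le {f h w : ℝ → ℝ} {C : ℝ} (hf : Continuous f) (hh : Continuous h)
    (hw : Continuous w) (hC : ∀ x, |w x| ≤ C) :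
    |∫ x in (-π)..π, f x * h x * w x| ≤ C * (L2norm f * L2norm h) := by
  have hC0 : 0 ≤ C := (abs_nonneg _).trans (hC 0)
  have hle : -π ≤ π := by linarith [pi_pos]
  have hcs := abs_integral_mul_le_L2norm_mul hf.abs hh.abs
  simp only [L2norm, sq_abs] at hcs
  calc |∫ x in (-π)..π, f x * h x * w x| ≤ ∫ x in (-π)..π, |f x * h x * w x| :=
        intervalIntegral.abs_integral_le_integral_abs hle
    _ ≤ ∫ x in (-π)..π, C * (|f x| * |h x|) := by
        refine intervalIntegral.integral_mono_on hle
          (Continuous.intervalIntegrable (by fun_prop) _ _)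
          (Continuous.intervalIntegrable (by fun_prop) _ _) fun x _ => ?_
        rw [abs_mul, abs_mul, mul_comm C]
        exact mul_le_mul_of_nonneg_left (hC x) (by positivity)
    _ = C * ∫ x in (-π)..π, |f x| * |h x| := intervalIntegral.integral_const_mul _ _
    _ ≤ C * (L2norm f * L2norm h) :=
        mul_le_mul_of_nonneg_left ((le_abs_self _).trans hcs) hC0

theorem L2norm_comp_sub_left {k : ℝ → ℝ} (hk : Function.Periodic k (2 * π)) (x : ℝ) :
    L2norm (fun y => k (x - y)) = L2norm k := by
  unfold L2norm
  have hp : Function.Periodic (fun y => k y ^ 2) (2 * π) := fun y => by simp only [hk y]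
  rw [intervalIntegral.integral_comp_sub_left (fun y => k y ^ 2) x]
  have := hp.intervalIntegral_add_eq (x - π) (-π)
  rw [show x - π + 2 * π = x - -π by ring, show -π + 2 * π = π by ring] at this
  rw [this]

/-- Young's inequality `‖k * f‖_∞ ≤ ‖k‖₂ ‖f‖₂` on the circle. -/
theorem abs_circConv_le {k f : ℝ → ℝ} (hk : Continuous k) (hkp : Function.Periodic k (2 * π))
    (hf : Continuous f) (x : ℝ) : |circConv k f x| ≤ L2norm k * L2norm f := by
  rw [← L2norm_comp_sub_left hkp x]
  exact abs_integral_mul_le_L2norm_mul (by fun_prop) hf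

theorem continuous_circConv {k f : ℝ → ℝ} (hk : Continuous k) (hf : Continuous f) :
    Continuous (circConv k f) :=
  intervalIntegral.continuous_parametric_intervalIntegral_of_continuous'
    (by unfold Function.uncurry; fun_prop) _ _

theorem circConv_periodic {k : ℝ → ℝ} {c : ℝ} (hk : Function.Periodic k c) (f : ℝ → ℝ) :
    Function.Periodic (circConv k f) c := fun x => by
  simp only [circConv, add_sub_right_comm, hk _]

theorem hasDerivAt_circConv {k f : ℝ → ℝ} (hk : ContDiff ℝ 1 k) (hf : Continuous f) (x : ℝ) :
    HasDerivAt (circConv k f) (circConv (deriv k) f x) x := by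
  have hk0 := hk.continuous
  have hk1 := hk.continuous_deriv le_rfl
  refine hasDerivAt_intervalIntegral_of_continuous_deriv
    (F := fun x y => k (x - y) * f y) (F' := fun x y => deriv k (x - y) * f y)
    (by unfold Function.uncurry; fun_prop) (by unfold Function.uncurry; fun_prop)
    (fun x y => ?_) _ _ x
  have := ((hk.differentiable one_ne_zero) (x - y)).hasDerivAt
  exact (this.comp_sub_const x y).mul_const (f y)

theorem integral_deriv_eq_zero_of_periodic {f f' : ℝ → ℝ} (hf : Function.Periodic f (2 * π))
    (hd : ∀ x, HasDerivAt f (f' x) x) (hf' : Continuous f') : ∫ x in (-π)..π, f' x = 0 := by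
  rw [intervalIntegral.integral_eq_sub_of_hasDerivAt (fun x _ => hd x)
    (hf'.intervalIntegrable _ _), sub_eq_zero, ← hf (-π)]
  congr 1; ring

/-- Energy estimate for the spatial right-hand side, with velocity `v`, `|v| ≤ A`, `|v'| ≤ B`. -/
theorem integral_energy_le {a a' r r' v v' : ℝ → ℝ} {A B M L : ℝ} (K : ℝ)
    (ha : ∀ x, HasDerivAt a (a' x) x) (ha' : Continuous a') (hap : Function.Periodic a (2 * π))
    (hr : Continuous r) (hr' : Continuous r')
    (hv : ∀ x, HasDerivAt v (v' x) x) (hv' : Continuous v') (hvp : Function.Periodic v (2 * π))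
    (hA : ∀ x, |v x| ≤ A) (hB : ∀ x, |v' x| ≤ B) (hM : L2norm r ≤ M) (hL : L2norm r' ≤ L) :
    ∫ x in (-π)..π, 2 * a x * (-K * a x + (r' x * v x + r x * v' x) - (a' x * v x + a x * v' x))
      ≤ -(2 * K) * L2norm a ^ 2 + 2 * (A * (L2norm a * L)) + 2 * (B * (L2norm a * M))
        + B * L2norm a ^ 2 := by
  have hac : Continuous a := continuous_iff_continuousAt.2 fun x => (ha x).continuousAt
  have hvc : Continuous v := continuous_iff_continuousAt.2 fun x => (hv x).continuousAt
  have hA0 : 0 ≤ A := (abs_nonneg _).trans (hA 0)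
  have hB0 : 0 ≤ B := (abs_nonneg _).trans (hB 0)
  have ha0 := L2norm_nonneg a
  have hsplit : ∫ x in (-π)..π,
      2 * a x * (-K * a x + (r' x * v x + r x * v' x) - (a' x * v x + a x * v' x))
      = ∫ x in (-π)..π, (-(2 * K) * a x ^ 2 + 2 * (a x * r' x * v x) + 2 * (a x * r x * v' x)
        - a x * a x * v' x - (2 * a x * a' x * v x + a x ^ 2 * v' x)) := by
    congr 1; ext x; ring
  have hzero : ∫ x in (-π)..π, (2 * a x * a' x * v x + a x ^ 2 * v' x) = 0 := by
    refine integral_deriv_eq_zero_of_periodic (f := fun x => a x ^ 2 * v x)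
      (fun x => by simp only [hap x, hvp x]) (fun x => ?_) (by fun_prop)
    simpa using ((ha x).fun_pow 2).fun_mul (hv x)
  rw [hsplit, intervalIntegral.integral_sub, intervalIntegral.integral_sub,
    intervalIntegral.integral_add, intervalIntegral.integral_add,
    intervalIntegral.integral_const_mul, intervalIntegral.integral_const_mul,
    intervalIntegral.integral_const_mul, ← L2norm_sq, hzero]
  · have h1 := (abs_le.1 (abs_integral_mul_mul_le hac hr' hvc hA)).2
    have h2 := (abs_le.1 (abs_integral_mul_mul_le hac hr hv' hB)).2
    have h3 := (abs_le.1 (abs_integral_mul_mul_le hac hac hv' hB)).1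
    have h4 : A * (L2norm a * L2norm r') ≤ A * (L2norm a * L) := by gcongr
    have h5 : B * (L2norm a * L2norm r) ≤ B * (L2norm a * M) := by gcongr
    rw [sq]
    linarith
  all_goals exact Continuous.intervalIntegrable (by fun_prop) _ _

/-- **Equation (19) of the paper.** Differential inequality for `‖e(t,·)‖₂²` under
limited sensing, with kernel mismatch `g` and `Ṽ(t,·) = g * e(t,·)`. -/
theorem norm_sq_diff_ineq_limited_sensing
    (g : ℝ → ℝ) (hg : ContDiff ℝ 1 g) (hgper : Function.Periodic g (2 * Real.pi))
    (M L : ℝ) (hM : 0 < M) (hL : 0 < L)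
    (ρd : ℝ → ℝ → ℝ)
    (hρd : ContDiff ℝ 1 (fun p : ℝ × ℝ => ρd p.1 p.2))
    (hρdper : ∀ t, Function.Periodic (ρd t) (2 * Real.pi))
    (hρdM : ∀ t, 0 ≤ t → L2norm (ρd t) ≤ M)
    (hρdL : ∀ t, 0 ≤ t → L2norm (fun x => deriv (ρd t) x) ≤ L)
    (Kp : ℝ)
    (e : ℝ → ℝ → ℝ)
    (he1 : ContDiff ℝ 1 (fun p : ℝ × ℝ => e p.1 p.2))
    (he2 : ∀ t, ContDiff ℝ 2 (e t))
    (heper : ∀ t, Function.Periodic (e t) (2 * Real.pi))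
    (hdyn : ∀ t, 0 ≤ t → ∀ x : ℝ,
      HasDerivAt (fun τ => e τ x)
        (-Kp * e t x
          + deriv (fun y => ρd t y * circConv g (e t) y) x
          - deriv (fun y => e t y * circConv g (e t) y) x) t) :
    ∀ t, 0 ≤ t → ∃ y : ℝ,
      HasDerivAt (fun τ => ∫ x in (-Real.pi)..Real.pi, e τ x ^ 2) y t ∧
        y ≤ (-(2 * Kp) + 2 * M * L2norm (fun x => deriv g x)
              + 2 * L * L2norm g
              + L2norm (fun x => deriv g x) * L2norm (e t)) * L2norm (e t) ^ 2 := by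
  intro t ht
  have hec : Continuous (e t) := (he2 t).continuous
  have hgc' : Continuous (deriv g) := hg.continuous_deriv le_rfl
  have hρt : ContDiff ℝ 1 (ρd t) :=
    hρd.comp (by fun_prop : ContDiff ℝ 1 fun x : ℝ => (t, x))
  have ha (x : ℝ) : HasDerivAt (e t) (deriv (e t) x) x :=
    ((he2 t).differentiable two_ne_zero x).hasDerivAt
  have hr (x : ℝ) : HasDerivAt (ρd t) (deriv (ρd t) x) x :=
    (hρt.differentiable one_ne_zero x).hasDerivAt
  have hv := hasDerivAt_circConv hg hec
  let D : ℝ → ℝ → ℝ := fun τ x => fderiv ℝ (fun p : ℝ × ℝ => e p.1 p.2) (τ, x) (1, 0)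
  have hDc : Continuous D.uncurry :=
    (he1.continuous_fderiv one_ne_zero).clm_apply continuous_const
  have hD (τ x : ℝ) : HasDerivAt (fun s => e s x) (D τ x) τ :=
    HasFDerivAt.comp_hasDerivAt (l := fun p : ℝ × ℝ => e p.1 p.2) (f := fun s => (s, x)) τ
      (he1.differentiable one_ne_zero (τ, x)).hasFDerivAt
      ((hasDerivAt_id τ).prodMk (hasDerivAt_const τ x))
  have hDt (x : ℝ) : D t x = -Kp * e t x
      + (deriv (ρd t) x * circConv g (e t) x + ρd t x * circConv (deriv g) (e t) x)
      - (deriv (e t) x * circConv g (e t) x + e t x * circConv (deriv g) (e t) x) := by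
    rw [(hD t x).unique (hdyn t ht x)]
    congr 2
    · exact ((hr x).mul (hv x)).deriv
    · exact ((ha x).mul (hv x)).deriv
  have hderiv := hasDerivAt_intervalIntegral_of_continuous_deriv
    (F := fun τ x => e τ x ^ 2) (F' := fun τ x => 2 * e τ x * D τ x)
    ((continuous_pow 2).comp he1.continuous) ((he1.continuous.const_mul 2).mul hDc)
    (fun τ x => by simpa using (hD τ x).fun_pow 2) (-π) π t
  refine ⟨_, hderiv, ?_⟩
  simp only [hDt]
  refine (integral_energy_le Kp ha ((he2 t).continuous_deriv one_le_two) (heper t)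
    hρt.continuous (hρt.continuous_deriv le_rfl) hv (continuous_circConv hgc' hec)
    (circConv_periodic hgper _) (abs_circConv_le hg.continuous hgper hec)
    (abs_circConv_le hgc' hgper.deriv_real hec) (hρdM t ht) (hρdL t ht)).trans (le_of_eq ?_)
  ring
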